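/- (Packing bound for DTM sublevel sets.) Let μ be a probability measure on ℝ^d and δ > 0. Define the sublevel set L_{μ,δ} = {x ∈ ℝ^d : d_μ(x) < δ}. If x₁, …, x_N are points of L_{μ,δ} with ‖x_i − x_j‖ ≥ 4δ for all i ≠ j, then N ≤ 2/m. In particular, the 4δ-packing number and the 4δ-covering number of L_{μ,δ} are both at most 2/m. -/

import Mathlib

open MeasureTheory Metric Set ProbabilityTheory
open scoped ENNReal NNReal

noncomputable section

/-- Euclidean space `ℝ^d`. -/
abbrev Euc (d : ℕ) := EuclideanSpace ℝ (Fin d)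

/-- The pseudo-distance-to-measure `δ_{μ,u}(x) = inf {r > 0 : μ(B(x,r)) > u}`. -/
def pseudoDTM {d : ℕ} (μ : Measure (Euc d)) (u : ℝ) (x : Euc d) : ℝ :=
  sInf {r : ℝ | 0 < r ∧ u < (μ (ball x r)).toReal}

/-- The distance-to-measure `d_μ(x) = ((1/m) ∫₀^m δ_{μ,u}(x)^p du)^{1/p}`. -/
def dtm {d : ℕ} (m p : ℝ) (μ : Measure (Euc d)) (x : Euc d) : ℝ :=
  ((1 / m) * ∫ u in Ioc (0 : ℝ) m, pseudoDTM μ u x ^ p) ^ (1 / p)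

/-- A Lipschitz path. -/
def IsLipschitzPath {d : ℕ} (γ : ℝ → Euc d) : Prop := ∃ K, LipschitzWith K γ

/-- Euclidean length `|γ| = ∫₀¹ ‖γ'(t)‖ dt`. -/
def eucLength {d : ℕ} (γ : ℝ → Euc d) : ℝ := ∫ t in Icc (0 : ℝ) 1, ‖deriv γ t‖

/-- FDTM length `D_μ(γ) = ∫₀¹ d_μ(γ(t))^β ‖γ'(t)‖ dt`. -/
def fdtmLength {d : ℕ} (m p β : ℝ) (μ : Measure (Euc d)) (γ : ℝ → Euc d) : ℝ :=
  ∫ t in Icc (0 : ℝ) 1, dtm m p μ (γ t) ^ β * ‖deriv γ t‖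

/-- Admissible paths `Γ_F(x,y)`: Lipschitz paths from `x` to `y` which may leave the domain `F`
only along straight lines. -/
def AdmissiblePath {d : ℕ} (F : Set (Euc d)) (x y : Euc d) (γ : ℝ → Euc d) : Prop :=
  IsLipschitzPath γ ∧ γ 0 = x ∧ γ 1 = y ∧
    ∀ a b : ℝ, 0 ≤ a → b ≤ 1 →
      (∀ t ∈ Ioo a b, γ t ∉ F) →
      ∃ u : Euc d, ‖u‖ = 1 ∧
        ∀ᵐ t ∂(volume.restrict (Ioo a b)), deriv γ t = ‖deriv γ t‖ • u

/-- The Fermat distance-to-measure `D_{μ,F}(x,y) = inf_{γ ∈ Γ_F(x,y)} D_μ(γ)`. -/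
def fdtm {d : ℕ} (m p β : ℝ) (μ : Measure (Euc d)) (F : Set (Euc d)) (x y : Euc d) : ℝ :=
  sInf {L : ℝ | ∃ γ : ℝ → Euc d, AdmissiblePath F x y γ ∧ L = fdtmLength m p β μ γ}

/-- A geodesic: an admissible path realizing the FDTM. -/
def IsGeodesic {d : ℕ} (m p β : ℝ) (μ : Measure (Euc d)) (F : Set (Euc d)) (x y : Euc d)
    (γ : ℝ → Euc d) : Prop :=
  AdmissiblePath F x y γ ∧ fdtmLength m p β μ γ = fdtm m p β μ F x y

/-- FDTM length of the straight segment `[x,y]`. -/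
def segFDTM {d : ℕ} (m p β : ℝ) (μ : Measure (Euc d)) (x y : Euc d) : ℝ :=
  ‖x - y‖ * ∫ t in Icc (0 : ℝ) 1, dtm m p μ ((1 - t) • x + t • y) ^ β

/-- The explicit constant `λ = 2·c·ρ^{β+1}/(ρ−1)` with `c = (16·5^β + 1152·165^β)/m^{2+β}`
and `ρ = 1 + 32/m`. -/
def fdtmConst (m β : ℝ) : ℝ :=
  2 * ((16 * (5 : ℝ) ^ β + 1152 * (165 : ℝ) ^ β) / m ^ (2 + β)) * (1 + 32 / m) ^ (β + 1) /
    ((1 + 32 / m) - 1)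

/-- Support of a measure: points all of whose neighborhoods have positive mass. -/
def measSupport {d : ℕ} (μ : Measure (Euc d)) : Set (Euc d) :=
  {x | ∀ r : ℝ, 0 < r → 0 < μ (ball x r)}

/-- `(a,b)`-standard measure: `μ(B(x,r)) ≥ a·r^b` for `x ∈ supp(μ)` and `0 < r ≤ a^{-1/b}`. -/
def IsStandard {d : ℕ} (μ : Measure (Euc d)) (a b : ℝ) : Prop :=
  ∀ x ∈ measSupport μ, ∀ r : ℝ, 0 < r → r ≤ a ^ (-(1 / b)) → a * r ^ b ≤ (μ (ball x r)).toReal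

lemma pseudoDTM_nonneg {d : ℕ} (μ : Measure (Euc d)) (u : ℝ) (x : Euc d) :
    0 ≤ pseudoDTM μ u x :=
  Real.sInf_nonneg fun _ hr => hr.1.le

lemma exists_lt_measure_ball {d : ℕ} (μ : Measure (Euc d)) [IsProbabilityMeasure μ]
    {u : ℝ} (hu : u < 1) (x : Euc d) :
    ∃ r : ℝ, 0 < r ∧ u < (μ (ball x r)).toReal := by
  have hmono : Monotone fun n : ℕ => ball x ((n : ℝ) + 1) := fun a b hab =>
    ball_subset_ball (by gcongr)
  have huniv : ⋃ n : ℕ, ball x ((n : ℝ) + 1) = univ := by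
    refine eq_univ_of_forall fun y => mem_iUnion.2 ?_
    obtain ⟨n, hn⟩ := exists_nat_ge (dist y x)
    exact ⟨n, mem_ball.2 (by linarith)⟩
  have hlim := tendsto_measure_iUnion_atTop (μ := μ) hmono
  rw [huniv, measure_univ] at hlim
  have hreal := (ENNReal.tendsto_toReal ENNReal.one_ne_top).comp hlim
  rw [ENNReal.toReal_one] at hreal
  obtain ⟨n, hn⟩ := (hreal.eventually (lt_mem_nhds hu)).exists
  exact ⟨n + 1, by positivity, hn⟩

lemma pseudoDTM_mono {d : ℕ} (μ : Measure (Euc d)) [IsProbabilityMeasure μ]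
    {u v : ℝ} (huv : u ≤ v) (hv : v < 1) (x : Euc d) :
    pseudoDTM μ u x ≤ pseudoDTM μ v x :=
  csInf_le_csInf ⟨0, fun _ hr => hr.1.le⟩ (exists_lt_measure_ball μ hv x)
    fun _ hr => ⟨hr.1, huv.trans_lt hr.2⟩

lemma le_pseudoDTM {d : ℕ} (μ : Measure (Euc d)) [IsProbabilityMeasure μ]
    {u r : ℝ} (hu : u < 1) {x : Euc d} (hr : (μ (ball x r)).toReal ≤ u) :
    r ≤ pseudoDTM μ u x := by
  refine le_csInf (exists_lt_measure_ball μ hu x) fun s hs => ?_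
  by_contra! hsr
  have : (μ (ball x s)).toReal ≤ (μ (ball x r)).toReal :=
    ENNReal.toReal_mono (measure_ne_top μ _) (measure_mono (ball_subset_ball hsr.le))
  linarith [hs.2]

lemma integrableOn_pseudoDTM_rpow {d : ℕ} (μ : Measure (Euc d)) [IsProbabilityMeasure μ]
    {m p : ℝ} (hm : m < 1) (hp : 0 ≤ p) (x : Euc d) :
    IntegrableOn (fun u => pseudoDTM μ u x ^ p) (Ioc 0 m) := by
  have hmono : MonotoneOn (fun u => pseudoDTM μ u x ^ p) (Icc 0 m) := fun u _ v hv huv =>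
    Real.rpow_le_rpow (pseudoDTM_nonneg μ u x) (pseudoDTM_mono μ huv (hv.2.trans_lt hm) x) hp
  exact (hmono.integrableOn_isCompact isCompact_Icc).mono_set Ioc_subset_Icc_self

lemma half_le_measure_ball_of_dtm_lt {d : ℕ} {m p : ℝ} (hm : m ∈ Ioo (0 : ℝ) 1) (hp : 1 ≤ p)
    (μ : Measure (Euc d)) [IsProbabilityMeasure μ] {δ : ℝ} (hδ : 0 < δ) {x : Euc d}
    (hx : dtm m p μ x < δ) : m / 2 ≤ (μ (ball x (2 * δ))).toReal := by
  obtain ⟨hm0, hm1⟩ := hm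
  have hp0 : 0 < p := by linarith
  by_contra! hlt
  refine hx.not_ge ?_
  have hint := integrableOn_pseudoDTM_rpow μ hm1 hp0.le x
  have hsub : Ioc (m / 2) m ⊆ Ioc 0 m := Ioc_subset_Ioc_left (by linarith)
  have hlower : m / 2 * (2 * δ) ^ p ≤ ∫ u in Ioc 0 m, pseudoDTM μ u x ^ p := by
    calc m / 2 * (2 * δ) ^ p = ∫ _ in Ioc (m / 2) m, (2 * δ) ^ p := by
          rw [setIntegral_const, Measure.real, Real.volume_Ioc,
            ENNReal.toReal_ofReal (by linarith), smul_eq_mul]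
          ring
      _ ≤ ∫ u in Ioc (m / 2) m, pseudoDTM μ u x ^ p :=
          setIntegral_mono_on (integrableOn_const (by simp)) (hint.mono_set hsub)
            measurableSet_Ioc fun u hu => Real.rpow_le_rpow (by positivity)
              (le_pseudoDTM μ (hu.2.trans_lt hm1) (hlt.trans hu.1).le) hp0.le
      _ ≤ ∫ u in Ioc 0 m, pseudoDTM μ u x ^ p :=
          setIntegral_mono_set hint
            (ae_of_all _ fun u => Real.rpow_nonneg (pseudoDTM_nonneg μ u x) p)
            hsub.eventuallyLE
  have htwo : (2 : ℝ) ≤ 2 ^ p := Real.self_le_rpow_of_one_le (by norm_num) hp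
  have hδp : 0 < δ ^ p := Real.rpow_pos_of_pos hδ p
  have hmean : δ ^ p ≤ (1 / m) * ∫ u in Ioc 0 m, pseudoDTM μ u x ^ p := by
    calc δ ^ p ≤ (1 / m) * (m / 2 * (2 * δ) ^ p) := by
          rw [Real.mul_rpow (by norm_num) hδ.le]
          field_simp
          nlinarith
      _ ≤ _ := by gcongr
  calc δ = (δ ^ p) ^ (1 / p) := by
        rw [one_div, Real.rpow_rpow_inv hδ.le hp0.ne']
    _ ≤ dtm m p μ x := Real.rpow_le_rpow hδp.le hmean (by positivity)

lemma card_le_of_dtm_lt_of_separated {d : ℕ} {m p : ℝ} (hm : m ∈ Ioo (0 : ℝ) 1) (hp : 1 ≤ p)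
    (μ : Measure (Euc d)) [IsProbabilityMeasure μ] {δ : ℝ} (hδ : 0 < δ)
    {ι : Type*} (s : Finset ι) (x : ι → Euc d) (hx : ∀ i ∈ s, dtm m p μ (x i) < δ)
    (hsep : (s : Set ι).Pairwise fun i j => 4 * δ ≤ dist (x i) (x j)) :
    (s.card : ℝ) ≤ 2 / m := by
  have hdisj : (s : Set ι).PairwiseDisjoint fun i => ball (x i) (2 * δ) :=
    fun i hi j hj hij => ball_disjoint_ball (by linarith [hsep hi hj hij])
  have hle : (s.card : ℝ) * (m / 2) ≤ 1 := by
    calc (s.card : ℝ) * (m / 2) = ∑ _i ∈ s, m / 2 := by simp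
      _ ≤ ∑ i ∈ s, μ.real (ball (x i) (2 * δ)) :=
          Finset.sum_le_sum fun i hi => half_le_measure_ball_of_dtm_lt hm hp μ hδ (hx i hi)
      _ = μ.real (⋃ i ∈ s, ball (x i) (2 * δ)) :=
          (measureReal_biUnion_finset hdisj fun _ _ => measurableSet_ball).symm
      _ ≤ 1 := measureReal_le_one
  rw [le_div_iff₀ hm.1]
  linarith

/-- If the separated finite subsets of `A` have bounded cardinality, one of them is a net. -/
lemma exists_finset_cover_of_card_le {α : Type*} [PseudoMetricSpace α] {A : Set α} {r C : ℝ}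
    (hC : ∀ s : Finset α, ↑s ⊆ A → (s : Set α).Pairwise (fun y z => r ≤ dist y z) →
      (s.card : ℝ) ≤ C) (hr : 0 < r) :
    ∃ s : Finset α, (s.card : ℝ) ≤ C ∧ A ⊆ ⋃ c ∈ s, ball c r := by
  classical
  by_contra! hcover
  have hlarge : ∀ n : ℕ, ∃ s : Finset α, s.card = n ∧ ↑s ⊆ A ∧
      (s : Set α).Pairwise fun y z => r ≤ dist y z := by
    intro n
    induction n with
    | zero => exact ⟨∅, by simp⟩
    | succ n ih =>
      obtain ⟨s, hcard, hsA, hs⟩ := ih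
      obtain ⟨z, hzA, hz⟩ := not_subset.1 (hcover s (hC s hsA hs))
      have hfar : ∀ c ∈ s, r ≤ dist z c := by simpa using hz
      have hzs : z ∉ s := fun h => by
        have := hfar z h
        rw [dist_self] at this
        linarith
      refine ⟨insert z s, by rw [Finset.card_insert_of_notMem hzs, hcard], ?_, ?_⟩
      · rw [Finset.coe_insert]
        exact insert_subset hzA hsA
      · rw [Finset.coe_insert]
        exact hs.insert fun c hc _ => ⟨hfar c hc, dist_comm z c ▸ hfar c hc⟩
  obtain ⟨n, hn⟩ := exists_nat_gt C
  obtain ⟨s, hcard, hsA, hs⟩ := hlarge n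
  have := hC s hsA hs
  rw [hcard] at this
  linarith

theorem dtm_sublevel_packing {d : ℕ} (m p : ℝ) (hm : m ∈ Set.Ioo (0 : ℝ) 1) (hp : 1 ≤ p)
    (μ : Measure (Euc d)) [IsProbabilityMeasure μ] (δ : ℝ) (hδ : 0 < δ)
    (N : ℕ) (x : Fin N → Euc d) (hxL : ∀ i, dtm m p μ (x i) < δ)
    (hsep : ∀ i j, i ≠ j → 4 * δ ≤ dist (x i) (x j)) :
    ((N : ℝ) ≤ 2 / m) ∧
      ∃ s : Finset (Euc d), (s.card : ℝ) ≤ 2 / m ∧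
        {z : Euc d | dtm m p μ z < δ} ⊆ ⋃ c ∈ s, ball c (4 * δ) := by
  refine ⟨?_, exists_finset_cover_of_card_le (fun s hsA hs =>
    card_le_of_dtm_lt_of_separated hm hp μ hδ s id (fun i hi => hsA hi) hs) (by positivity)⟩
  simpa using card_le_of_dtm_lt_of_separated hm hp μ hδ Finset.univ x (fun i _ => hxL i)
    fun i _ j _ hij => hsep i j hij

end
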